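/- arXiv:1710.02817 — 5 statements merged into one kernel-verified Lean document; each statement's English description precedes it below -/
import Mathlib

section
/- Let P1, P2, P3 be paradigms over finite nonempty index sets. For every merged paradigm Q of P1 and P2, one has msize(Q, P3) ≥ msize(P1, P3); that is, every merged paradigm R of Q and P3 satisfies size(R) ≥ msize(P1, P3). -/
/-- The size of a paradigm `P : I → Fin n → α`: the sum over columns of the metric
diameter of the column set `P[i] = {P s i : s ∈ I}`. -/
noncomputable def psize {α : Type*} [PseudoMetricSpace α] {I : Type*} {n : ℕ}
    (P : I → Fin n → α) : ℝ :=
  ∑ i : Fin n, Metric.diam (Set.range fun s => P s i)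

/-- `Q` is a column-insertion of `P`: there is a strictly monotone map `f` of the columns
of `P` into the columns of `Q` such that `Q` agrees with `P` along `f` and is `null`
on all other columns. -/
def IsColInsertion {α : Type*} (null : α) {I : Type*} {n m : ℕ}
    (Q : I → Fin m → α) (P : I → Fin n → α) : Prop :=
  ∃ f : Fin n → Fin m, StrictMono f ∧
    (∀ s i, Q s (f i) = P s i) ∧
    ∀ s j, j ∉ Set.range f → Q s j = null

/-- `Q` is a merged paradigm of `P1` and `P2`: its restriction to `I1` is a
column-insertion of `P1` and its restriction to `I2` is a column-insertion of `P2`. -/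
def IsMergedParadigm {α : Type*} (null : α) {I1 I2 : Type*} {n1 n2 m : ℕ}
    (P1 : I1 → Fin n1 → α) (P2 : I2 → Fin n2 → α) (Q : I1 ⊕ I2 → Fin m → α) : Prop :=
  IsColInsertion null (fun s => Q (Sum.inl s)) P1 ∧
  IsColInsertion null (fun s => Q (Sum.inr s)) P2

/-- The merging size `msize(P1, P2)`: the infimum of `size(Q)` over all merged
paradigms `Q` of `P1` and `P2`. -/
noncomputable def msize {α : Type*} [PseudoMetricSpace α] (null : α) {I1 I2 : Type*}
    {n1 n2 : ℕ} (P1 : I1 → Fin n1 → α) (P2 : I2 → Fin n2 → α) : ℝ :=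
  sInf {r : ℝ | ∃ (m : ℕ) (Q : I1 ⊕ I2 → Fin m → α),
    IsMergedParadigm null P1 P2 Q ∧ psize Q = r}

theorem IsColInsertion.trans {α : Type*} {null : α} {I : Type*} {n m k : ℕ}
    {R : I → Fin k → α} {Q : I → Fin m → α} {P : I → Fin n → α}
    (hRQ : IsColInsertion null R Q) (hQP : IsColInsertion null Q P) :
    IsColInsertion null R P := by
  obtain ⟨g, hg, hgR, hgn⟩ := hRQ
  obtain ⟨f, hf, hfQ, hfn⟩ := hQP
  refine ⟨g ∘ f, hg.comp hf, fun s i => by simp [hgR, hfQ], fun s j hj => ?_⟩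
  by_cases h : j ∈ Set.range g
  · obtain ⟨l, rfl⟩ := h
    rw [hgR]
    refine hfn s l ?_
    rintro ⟨i, rfl⟩
    exact hj ⟨i, rfl⟩
  · exact hgn s j h

theorem IsColInsertion.reindex {α : Type*} {null : α} {I J : Type*} {n m : ℕ}
    {Q : I → Fin m → α} {P : I → Fin n → α} (h : IsColInsertion null Q P) (e : J → I) :
    IsColInsertion null (fun s => Q (e s)) (fun s => P (e s)) := by
  obtain ⟨f, hf, hfQ, hfn⟩ := h
  exact ⟨f, hf, fun s => hfQ (e s), fun s => hfn (e s)⟩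

/-- Merged paradigms exist: place the columns of `P1` before those of `P2`. -/
theorem exists_isMergedParadigm {α : Type*} (null : α) {I1 I2 : Type*} {n1 n2 : ℕ}
    (P1 : I1 → Fin n1 → α) (P2 : I2 → Fin n2 → α) :
    ∃ (m : ℕ) (Q : I1 ⊕ I2 → Fin m → α), IsMergedParadigm null P1 P2 Q := by
  refine ⟨n1 + n2, Sum.elim (fun s => Fin.append (P1 s) fun _ => null)
    (fun s => Fin.append (fun _ => null) (P2 s)),
    ⟨Fin.castAdd n2, Fin.strictMono_castAdd n2, by simp, fun s j hj => ?_⟩,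
    ⟨Fin.natAdd n1, Fin.strictMono_natAdd n1, by simp, fun s j hj => ?_⟩⟩
  · induction j using Fin.addCases with
    | left i => exact absurd ⟨i, rfl⟩ hj
    | right i => simp
  · induction j using Fin.addCases with
    | left i => simp
    | right i => exact absurd ⟨i, rfl⟩ hj

theorem psize_nonneg {α : Type*} [PseudoMetricSpace α] {I : Type*} {n : ℕ}
    (P : I → Fin n → α) : 0 ≤ psize P :=
  Finset.sum_nonneg fun _ _ => Metric.diam_nonneg

theorem psize_reindex_le {α : Type*} [PseudoMetricSpace α] {I J : Type*} [Finite I] {n : ℕ}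
    (P : I → Fin n → α) (e : J → I) : psize (fun s => P (e s)) ≤ psize P :=
  Finset.sum_le_sum fun i _ => Metric.diam_mono
    (Set.range_comp_subset_range e fun s => P s i) (Set.finite_range _).isBounded

theorem msize_le_psize {α : Type*} [PseudoMetricSpace α] {null : α} {I1 I2 : Type*}
    {n1 n2 m : ℕ} {P1 : I1 → Fin n1 → α} {P2 : I2 → Fin n2 → α} {Q : I1 ⊕ I2 → Fin m → α}
    (hQ : IsMergedParadigm null P1 P2 Q) : msize null P1 P2 ≤ psize Q := by
  refine csInf_le ⟨0, ?_⟩ ⟨m, Q, hQ, rfl⟩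
  rintro _ ⟨_, R, _, rfl⟩
  exact psize_nonneg R

/-- For every merged paradigm `Q` of `P1` and `P2`, one has
`msize(Q, P3) ≥ msize(P1, P3)`; that is, every merged paradigm `R` of `Q` and `P3`
satisfies `size(R) ≥ msize(P1, P3)`. -/
theorem msize_merged_left_ge {α : Type*} [PseudoMetricSpace α] (null : α)
    {I1 I2 I3 : Type*} [Fintype I1] [Nonempty I1] [Fintype I2] [Nonempty I2]
    [Fintype I3] [Nonempty I3] {n1 n2 n3 : ℕ}
    (P1 : I1 → Fin n1 → α) (P2 : I2 → Fin n2 → α) (P3 : I3 → Fin n3 → α)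
    {m : ℕ} (Q : I1 ⊕ I2 → Fin m → α) (hQ : IsMergedParadigm null P1 P2 Q) :
    msize null P1 P3 ≤ msize null Q P3 ∧
    ∀ (m' : ℕ) (R : (I1 ⊕ I2) ⊕ I3 → Fin m' → α),
      IsMergedParadigm null Q P3 R → msize null P1 P3 ≤ psize R := by
  have key : ∀ (m' : ℕ) (R : (I1 ⊕ I2) ⊕ I3 → Fin m' → α),
      IsMergedParadigm null Q P3 R → msize null P1 P3 ≤ psize R := fun m' R hR =>
    (msize_le_psize (Q := fun s => R (Sum.map Sum.inl id s))
      ⟨(hR.1.reindex Sum.inl).trans hQ.1, hR.2⟩).trans (psize_reindex_le R _)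
  refine ⟨le_csInf ?_ ?_, key⟩
  · obtain ⟨m', R, hR⟩ := exists_isMergedParadigm null Q P3
    exact ⟨_, m', R, hR, rfl⟩
  · rintro _ ⟨m', R, hR, rfl⟩
    exact key m' R hR
end

section
/- (Pseudo triangular inequality.) Let P1, P2, P3 be paradigms over finite nonempty index sets. For every merged paradigm Q of P1 and P2, one has msize(Q, P3) ≤ msize(P1, P3) + size(Q); in particular, for a size-minimizing merge of P1 and P2 this gives msize(P1 ⊎ P2, P3) ≤ msize(P1, P3) + msize(P1, P2). -/
/-- Insert constant `null` columns into `P`, moving its columns along `u`. -/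
noncomputable def colExtend {α : Type*} (null : α) {I : Type*} {n m : ℕ}
    (u : Fin n → Fin m) (P : I → Fin n → α) : I → Fin m → α :=
  fun s => Function.extend u (P s) fun _ => null

theorem isColInsertion_iff {α : Type*} {null : α} {I : Type*} {n m : ℕ}
    {Q : I → Fin m → α} {P : I → Fin n → α} :
    IsColInsertion null Q P ↔ ∃ f : Fin n → Fin m, StrictMono f ∧ Q = colExtend null f P := by
  constructor
  · rintro ⟨f, hf, h1, h2⟩
    refine ⟨f, hf, ?_⟩
    ext s j
    by_cases hj : j ∈ Set.range f
    · obtain ⟨i, rfl⟩ := hj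
      simp [colExtend, hf.injective.extend_apply, h1]
    · simp [colExtend, Function.extend_apply' _ _ _ hj, h2 s j hj]
  · rintro ⟨f, hf, rfl⟩
    exact ⟨f, hf, fun s i => hf.injective.extend_apply _ _ _,
      fun s j hj => Function.extend_apply' _ _ _ hj⟩

theorem colExtend_colExtend {α : Type*} (null : α) {I : Type*} {n m k : ℕ}
    {f : Fin n → Fin m} {u : Fin m → Fin k} (hf : StrictMono f) (hu : StrictMono u)
    (P : I → Fin n → α) :
    colExtend null u (colExtend null f P) = colExtend null (u ∘ f) P := by
  ext s j
  by_cases hj : ∃ a, u a = j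
  · obtain ⟨a, rfl⟩ := hj
    by_cases ha : ∃ i, f i = a
    · obtain ⟨i, rfl⟩ := ha
      have := (hu.comp hf).injective.extend_apply (P s) (fun _ => null) i
      simp only [Function.comp_apply] at this
      simp [colExtend, hu.injective.extend_apply, hf.injective.extend_apply, this]
    · have h : ¬ ∃ i, (u ∘ f) i = u a := fun ⟨i, hi⟩ => ha ⟨i, hu.injective hi⟩
      simp only [colExtend, hu.injective.extend_apply, Function.extend_apply' _ _ _ ha,
        Function.extend_apply' _ _ _ h]
  · have h : ¬ ∃ i, (u ∘ f) i = j := fun ⟨i, hi⟩ => hj ⟨f i, hi⟩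
    simp only [colExtend, Function.extend_apply' _ _ _ hj, Function.extend_apply' _ _ _ h]

theorem psize_colExtend {α : Type*} [PseudoMetricSpace α] (null : α) {I : Type*} {n m : ℕ}
    {u : Fin n → Fin m} (hu : StrictMono u) (P : I → Fin n → α) :
    psize (colExtend null u P) = psize P := by
  refine (Fintype.sum_of_injective u hu.injective _ _ (fun j hj => ?_) fun i => ?_).symm
  · simp only [colExtend, Function.extend_apply' _ _ _ hj]
    exact Metric.diam_subsingleton (by rintro _ ⟨_, rfl⟩ _ ⟨_, rfl⟩; rfl)
  · simp only [colExtend, hu.injective.extend_apply]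

/-- Two strictly monotone maps out of `Fin n` complete to a commutative square of strictly
monotone maps. -/
theorem exists_strictMono_amalgam {n m k : ℕ} {f : Fin n → Fin m} {g : Fin n → Fin k}
    (hf : StrictMono f) (hg : StrictMono g) :
    ∃ (u : Fin m → Fin (m + k)) (v : Fin k → Fin (m + k)),
      StrictMono u ∧ StrictMono v ∧ u ∘ f = v ∘ g := by
  have key : ∀ {p q : ℕ} {f : Fin n → Fin p} {g : Fin n → Fin q}, StrictMono f → StrictMono g →
      ∃ u : Fin p → Fin (p + q), StrictMono u ∧ ∀ i, (u (f i) : ℕ) = f i + g i := by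
    intro p q f g hf hg
    let w : Fin p → ℕ := fun a => (Finset.univ.filter fun i => f i ≤ a).sup fun i => (g i : ℕ)
    have hw : Monotone w := fun a b hab =>
      Finset.sup_mono (Finset.monotone_filter_right _ fun i _ hi => le_trans hi hab)
    have hq : ∀ a, w a ≤ q := fun a => Finset.sup_le fun i _ => (g i).2.le
    refine ⟨fun a => ⟨a + w a, by have := hq a; omega⟩, fun a b hab => ?_, fun i => ?_⟩
    · have := hw hab.le
      have : (a : ℕ) < b := hab
      simp only [Fin.mk_lt_mk]
      omega
    · have : w (f i) = g i := by
        refine le_antisymm (Finset.sup_le fun j hj => ?_)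
          (Finset.le_sup (f := fun i => (g i : ℕ)) (by simp))
        exact hg.monotone (hf.le_iff_le.1 (Finset.mem_filter.1 hj).2)
      simp [this]
  obtain ⟨u, hu, huf⟩ := key hf hg
  obtain ⟨v, hv, hvg⟩ := key hg hf
  refine ⟨u, Fin.cast (Nat.add_comm k m) ∘ v, hu, fun a b hab => hv hab, ?_⟩
  ext i
  simp [huf, hvg, Nat.add_comm]

/-- Gluing two finite families along common members does not increase the total diameter. -/
theorem diam_range_glue_le {α : Type*} [PseudoMetricSpace α] {I1 I2 I3 : Type*}
    [Finite I1] [Nonempty I1] [Finite I2] [Finite I3] {x : I1 ⊕ I2 → α} {y : I1 ⊕ I3 → α}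
    (h : ∀ s, x (Sum.inl s) = y (Sum.inl s)) :
    Metric.diam (Set.range (Sum.elim x fun s => y (Sum.inr s))) ≤
      Metric.diam (Set.range x) + Metric.diam (Set.range y) := by
  have hx : ∀ s t, dist (x s) (x t) ≤ Metric.diam (Set.range x) := fun s t =>
    Metric.dist_le_diam_of_mem (Set.finite_range x).isBounded ⟨s, rfl⟩ ⟨t, rfl⟩
  have hy : ∀ s t, dist (y s) (y t) ≤ Metric.diam (Set.range y) := fun s t =>
    Metric.dist_le_diam_of_mem (Set.finite_range y).isBounded ⟨s, rfl⟩ ⟨t, rfl⟩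
  have hx0 : 0 ≤ Metric.diam (Set.range x) := Metric.diam_nonneg
  have hy0 : 0 ≤ Metric.diam (Set.range y) := Metric.diam_nonneg
  obtain ⟨s₀⟩ := ‹Nonempty I1›
  have hxy : ∀ s t, dist (x s) (y (Sum.inr t)) ≤
      Metric.diam (Set.range x) + Metric.diam (Set.range y) := fun s t =>
    (dist_triangle _ (x (Sum.inl s₀)) _).trans
      (add_le_add (hx _ _) ((h s₀).symm ▸ hy _ _))
  refine Metric.diam_le_of_forall_dist_le (add_nonneg hx0 hy0) ?_
  rintro _ ⟨s | s, rfl⟩ _ ⟨t | t, rfl⟩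
  · exact (hx s t).trans (le_add_of_nonneg_right hy0)
  · exact hxy s t
  · exact (dist_comm _ _).trans_le (hxy t s)
  · exact (hy _ _).trans (le_add_of_nonneg_left hx0)

theorem msize_le_psize_add_psize {α : Type*} [PseudoMetricSpace α] {null : α}
    {I1 I2 I3 : Type*} [Finite I1] [Nonempty I1] [Finite I2] [Finite I3] {n1 n2 n3 m k : ℕ}
    {P1 : I1 → Fin n1 → α} {P2 : I2 → Fin n2 → α} {P3 : I3 → Fin n3 → α}
    {Q : I1 ⊕ I2 → Fin m → α} {R : I1 ⊕ I3 → Fin k → α}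
    (hQ : IsMergedParadigm null P1 P2 Q) (hR : IsMergedParadigm null P1 P3 R) :
    msize null Q P3 ≤ psize Q + psize R := by
  obtain ⟨f, hf, hQf⟩ := isColInsertion_iff.1 hQ.1
  obtain ⟨g, hg, hRg⟩ := isColInsertion_iff.1 hR.1
  obtain ⟨g', hg', hRg'⟩ := isColInsertion_iff.1 hR.2
  obtain ⟨u, v, hu, hv, huv⟩ := exists_strictMono_amalgam hf hg
  have hglue : ∀ s, colExtend null u Q (Sum.inl s) = colExtend null v R (Sum.inl s) := by
    intro s
    change colExtend null u (fun s => Q (Sum.inl s)) s = colExtend null v (fun s => R (Sum.inl s)) s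
    rw [hQf, hRg, colExtend_colExtend null hf hu, colExtend_colExtend null hg hv, huv]
  have hT : IsMergedParadigm null Q P3
      (Sum.elim (colExtend null u Q) fun s => colExtend null v R (Sum.inr s)) := by
    refine ⟨isColInsertion_iff.2 ⟨u, hu, rfl⟩, isColInsertion_iff.2 ⟨v ∘ g', hv.comp hg', ?_⟩⟩
    rw [← colExtend_colExtend null hg' hv, ← hRg']
    rfl
  refine (msize_le_psize hT).trans ?_
  rw [← psize_colExtend null hu Q, ← psize_colExtend null hv R]
  unfold psize
  rw [← Finset.sum_add_distrib]
  refine Finset.sum_le_sum fun j _ => ?_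
  have h := diam_range_glue_le (x := fun s => colExtend null u Q s j)
    (y := fun s => colExtend null v R s j) fun s => congrFun (hglue s) j
  refine le_of_eq_of_le (congrArg (fun x => Metric.diam (Set.range x)) ?_) h
  ext (s | s) <;> rfl

/-- **Pseudo triangular inequality.** For every merged paradigm `Q` of
`P1` and `P2`, one has `msize(Q, P3) ≤ msize(P1, P3) + size(Q)`; in particular, for a
size-minimizing merge of `P1` and `P2` (i.e. `size(Q) = msize(P1, P2)`) this gives
`msize(P1 ⊎ P2, P3) ≤ msize(P1, P3) + msize(P1, P2)`. -/
theorem msize_pseudo_triangle {α : Type*} [PseudoMetricSpace α] (null : α)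
    {I1 I2 I3 : Type*} [Fintype I1] [Nonempty I1] [Fintype I2] [Nonempty I2]
    [Fintype I3] [Nonempty I3] {n1 n2 n3 : ℕ}
    (P1 : I1 → Fin n1 → α) (P2 : I2 → Fin n2 → α) (P3 : I3 → Fin n3 → α)
    {m : ℕ} (Q : I1 ⊕ I2 → Fin m → α) (hQ : IsMergedParadigm null P1 P2 Q) :
    msize null Q P3 ≤ msize null P1 P3 + psize Q ∧
    (psize Q = msize null P1 P2 →
      msize null Q P3 ≤ msize null P1 P3 + msize null P1 P2) := by
  have main : msize null Q P3 ≤ msize null P1 P3 + psize Q := by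
    rw [← sub_le_iff_le_add]
    obtain ⟨k, R, hR⟩ := exists_isMergedParadigm null P1 P3
    refine le_csInf ⟨_, k, R, hR, rfl⟩ ?_
    rintro _ ⟨k, R, hR, rfl⟩
    rw [sub_le_iff_le_add, add_comm]
    exact msize_le_psize_add_psize hQ hR
  exact ⟨main, fun h => h ▸ main⟩
end

section
/- (Correctness of independency-based pruning.) Let P1 and P2 be paradigms over finite nonempty index sets such that for every paradigm P in some collection 𝒫 with P ∉ {P1, P2}, msize(P1, P2) ≤ msize(P1, P) and msize(P1, P2) ≤ msize(P2, P). Then for any two paradigms P', P'' ∈ 𝒫 \ {P1, P2} and any merged paradigm Q of P' and P'', it still holds that msize(P1, P2) ≤ msize(P1, Q) and msize(P1, P2) ≤ msize(P2, Q); that is, merging another pair first cannot produce a paradigm whose merging size with P1 or P2 is smaller than msize(P1, P2). -/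
/-- Restricting a paradigm along a map of index sets does not increase its size. -/
theorem psize_comp_le {α : Type*} [PseudoMetricSpace α] {I J : Type*} [Finite I] {n : ℕ}
    (P : I → Fin n → α) (g : J → I) : psize (fun s => P (g s)) ≤ psize P := by
  refine Finset.sum_le_sum fun i _ => Metric.diam_mono ?_ (Set.finite_range _).isBounded
  rintro _ ⟨s, rfl⟩
  exact ⟨g s, rfl⟩

theorem IsColInsertion.comp {α : Type*} {null : α} {I J : Type*} {n m : ℕ}
    {Q : I → Fin m → α} {P : I → Fin n → α} (h : IsColInsertion null Q P) (g : J → I) :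
    IsColInsertion null (fun s => Q (g s)) (fun s => P (g s)) := by
  obtain ⟨f, hf, hval, hnull⟩ := h
  exact ⟨f, hf, fun s => hval (g s), fun s => hnull (g s)⟩

/-- If the restriction of `Q` along `g` is a column-insertion of `P'`, then merging a paradigm
with `P'` costs at most as much as merging it with `Q`. -/
theorem msize_le_msize_of_isColInsertion {α : Type*} [PseudoMetricSpace α] {null : α}
    {I J K : Type*} [Finite I] [Finite K] {n n' m : ℕ} (P : I → Fin n → α)
    {P' : J → Fin n' → α} {Q : K → Fin m → α} (g : J → K)
    (h : IsColInsertion null (fun s => Q (g s)) P') :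
    msize null P P' ≤ msize null P Q := by
  obtain ⟨k, R, hR⟩ := exists_isMergedParadigm null P Q
  refine le_csInf ⟨_, k, R, hR, rfl⟩ ?_
  rintro _ ⟨k, R, ⟨hRP, hRQ⟩, rfl⟩
  refine le_trans (csInf_le ⟨0, ?_⟩ ?_) (psize_comp_le R (Sum.map id g))
  rotate_left
  · exact ⟨k, fun s => R (Sum.map id g s), ⟨hRP, (hRQ.comp g).trans h⟩, rfl⟩
  rintro _ ⟨_, _, _, rfl⟩
  exact psize_nonneg _

/-- **Correctness of independency-based pruning.** Let `P1` and `P2` be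
paradigms over finite nonempty index sets such that for every paradigm `P` in some
collection `coll` with `P ∉ {P1, P2}`, `msize(P1, P2) ≤ msize(P1, P)` and
`msize(P1, P2) ≤ msize(P2, P)`.  Then for any two paradigms `P', P'' ∈ coll \ {P1, P2}`
and any merged paradigm `Q` of `P'` and `P''`, it still holds that
`msize(P1, P2) ≤ msize(P1, Q)` and `msize(P1, P2) ≤ msize(P2, Q)`; that is, merging
another pair first cannot produce a paradigm whose merging size with `P1` or `P2` is
smaller than `msize(P1, P2)`. -/
theorem independency_pruning_correct {α : Type*} [PseudoMetricSpace α] (null : α)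
    {I1 I2 : Type} [Fintype I1] [Nonempty I1] [Fintype I2] [Nonempty I2] {n1 n2 : ℕ}
    (P1 : I1 → Fin n1 → α) (P2 : I2 → Fin n2 → α)
    (coll : Set (Σ (I : Type) (n : ℕ), I → Fin n → α))
    (hfin : ∀ P ∈ coll, Finite P.1 ∧ Nonempty P.1)
    (hmin : ∀ P ∈ coll, P ≠ ⟨I1, n1, P1⟩ → P ≠ ⟨I2, n2, P2⟩ →
      msize null P1 P2 ≤ msize null P1 P.2.2 ∧ msize null P1 P2 ≤ msize null P2 P.2.2)
    (P' P'' : Σ (I : Type) (n : ℕ), I → Fin n → α)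
    (hP' : P' ∈ coll) (hP'' : P'' ∈ coll)
    (hP'1 : P' ≠ ⟨I1, n1, P1⟩) (hP'2 : P' ≠ ⟨I2, n2, P2⟩)
    (hP''1 : P'' ≠ ⟨I1, n1, P1⟩) (hP''2 : P'' ≠ ⟨I2, n2, P2⟩)
    {m : ℕ} (Q : P'.1 ⊕ P''.1 → Fin m → α)
    (hQ : IsMergedParadigm null P'.2.2 P''.2.2 Q) :
    msize null P1 P2 ≤ msize null P1 Q ∧ msize null P1 P2 ≤ msize null P2 Q := by
  have := (hfin P' hP').1
  have := (hfin P'' hP'').1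
  obtain ⟨h1, h2⟩ := hmin P' hP' hP'1 hP'2
  exact ⟨h1.trans (msize_le_msize_of_isColInsertion P1 Sum.inl hQ.1),
    h2.trans (msize_le_msize_of_isColInsertion P2 Sum.inl hQ.1)⟩
end

section
/- For any two paradigms P1 of length n1 and P2 of length n2 over finite nonempty index sets, the merging size is attained: there exists a merged paradigm Q of P1 and P2 with length m satisfying max(n1, n2) ≤ m ≤ n1 + n2 and size(Q) = msize(P1, P2). (In particular every merged paradigm has length at least max(n1, n2), and merged paradigms of length n1 + n2 always exist.) -/
/-- For fixed lengths, a paradigm has only finitely many column-insertions. -/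
theorem finite_setOf_isColInsertion {α : Type*} (null : α) {I : Type*} {n : ℕ} (m : ℕ)
    (P : I → Fin n → α) : {Q : I → Fin m → α | IsColInsertion null Q P}.Finite := by
  have h_union : {Q : I → Fin m → α | IsColInsertion null Q P} ⊆
      ⋃ f : Fin n → Fin m, {Q | (∀ s i, Q s (f i) = P s i) ∧
        ∀ s j, j ∉ Set.range f → Q s j = null} := by
    rintro Q ⟨f, -, hf⟩
    exact Set.mem_iUnion.2 ⟨f, hf⟩
  refine (Set.finite_iUnion fun f => Set.Subsingleton.finite ?_).subset h_union
  rintro Q ⟨hQ, hQnull⟩ R ⟨hR, hRnull⟩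
  ext s j
  by_cases hj : j ∈ Set.range f
  · obtain ⟨i, rfl⟩ := hj
    rw [hQ, hR]
  · rw [hQnull s j hj, hRnull s j hj]

/-- For fixed lengths, two paradigms have only finitely many merged paradigms. -/
theorem finite_setOf_isMergedParadigm {α : Type*} (null : α) {I1 I2 : Type*} {n1 n2 : ℕ}
    (m : ℕ) (P1 : I1 → Fin n1 → α) (P2 : I2 → Fin n2 → α) :
    {Q : I1 ⊕ I2 → Fin m → α | IsMergedParadigm null P1 P2 Q}.Finite := by
  refine Set.Finite.of_finite_image
    (f := fun Q : I1 ⊕ I2 → Fin m → α => (fun s => Q (Sum.inl s), fun s => Q (Sum.inr s)))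
    (((finite_setOf_isColInsertion null m P1).prod
      (finite_setOf_isColInsertion null m P2)).subset ?_) ?_
  · rintro _ ⟨Q, hQ, rfl⟩
    exact hQ
  · intro Q _ R _ h
    obtain ⟨h1, h2⟩ := Prod.mk.inj h
    ext (s | s) j
    · exact congrFun (congrFun h1 s) j
    · exact congrFun (congrFun h2 s) j

/-- Restricting a column-insertion to a set of columns that contains all the columns of the
original paradigm gives a column-insertion. -/
theorem IsColInsertion.restrict {α : Type*} {null : α} {I : Type*} {n m k : ℕ}
    {Q : I → Fin m → α} {P : I → Fin n → α} {f : Fin n → Fin m} (hf : StrictMono f)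
    (hQ : ∀ s i, Q s (f i) = P s i) (hnull : ∀ s j, j ∉ Set.range f → Q s j = null)
    (e : Fin k ↪o Fin m) (he : ∀ i, f i ∈ Set.range e) :
    IsColInsertion null (fun s j => Q s (e j)) P := by
  choose g hg using he
  refine ⟨g, fun i j hij => ?_, fun s i => ?_, fun s j hj => hnull s _ ?_⟩
  · rw [← e.lt_iff_lt, hg, hg]
    exact hf hij
  · simp only [hg, hQ]
  · rintro ⟨i, hi⟩
    exact hj ⟨i, e.injective ((hg i).trans hi)⟩

/-- Deleting the all-null columns of a merged paradigm leaves a merged paradigm of the same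
size and of length at most `n1 + n2`. -/
theorem IsMergedParadigm.exists_length_le {α : Type*} [PseudoMetricSpace α] {null : α}
    {I1 I2 : Type*} {n1 n2 m : ℕ} {P1 : I1 → Fin n1 → α} {P2 : I2 → Fin n2 → α}
    {Q : I1 ⊕ I2 → Fin m → α} (h : IsMergedParadigm null P1 P2 Q) :
    ∃ k ≤ n1 + n2, ∃ R : I1 ⊕ I2 → Fin k → α,
      IsMergedParadigm null P1 P2 R ∧ psize R = psize Q := by
  obtain ⟨⟨f, hf, hfQ, hfnull⟩, g, hg, hgQ, hgnull⟩ := h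
  let U : Finset (Fin m) := Finset.univ.image f ∪ Finset.univ.image g
  let e : Fin U.card ↪o Fin m := U.orderEmbOfFin rfl
  have h_range : Set.range e = U := U.range_orderEmbOfFin rfl
  refine ⟨U.card, ?_, fun s j => Q s (e j),
    ⟨.restrict hf hfQ hfnull e fun i => ?_, .restrict hg hgQ hgnull e fun i => ?_⟩, ?_⟩
  · refine (Finset.card_union_le _ _).trans (Nat.add_le_add ?_ ?_) <;>
      exact Finset.card_image_le.trans_eq (by simp)
  · simp [h_range, U]
  · simp [h_range, U]
  · refine Finset.sum_of_injOn e e.injective.injOn (by simp) (fun j _ hj => ?_) fun _ _ => rfl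
    have hjU : j ∉ U := by
      rwa [Finset.coe_univ, Set.image_univ, h_range, Finset.mem_coe] at hj
    simp only [U, Finset.mem_union, Finset.mem_image, Finset.mem_univ, true_and, not_or] at hjU
    refine Metric.diam_subsingleton (Set.subsingleton_singleton (a := null) |>.anti ?_)
    rintro _ ⟨s | s, rfl⟩
    · exact hfnull s j hjU.1
    · exact hgnull s j hjU.2

/-- A column-insertion is at least as long as the original paradigm. -/
theorem IsColInsertion.length_le {α : Type*} {null : α} {I : Type*} {n m : ℕ}
    {Q : I → Fin m → α} {P : I → Fin n → α} (h : IsColInsertion null Q P) : n ≤ m := by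
  obtain ⟨f, hf, -⟩ := h
  simpa using Fintype.card_le_of_injective f hf.injective

/-- Placing the columns of two paradigms side by side gives a merged paradigm. -/
theorem exists_isMergedParadigm_add {α : Type*} (null : α) {I1 I2 : Type*} {n1 n2 : ℕ}
    (P1 : I1 → Fin n1 → α) (P2 : I2 → Fin n2 → α) :
    ∃ Q : I1 ⊕ I2 → Fin (n1 + n2) → α, IsMergedParadigm null P1 P2 Q := by
  refine ⟨Sum.elim (fun s => Fin.append (P1 s) fun _ => null)
    (fun s => Fin.append (fun _ => null) (P2 s)),
    ⟨Fin.castAdd n2, Fin.strictMono_castAdd n2, by simp, fun s j => ?_⟩,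
    ⟨Fin.natAdd n1, Fin.strictMono_natAdd n1, by simp, fun s j => ?_⟩⟩
  · refine Fin.addCases (fun i hi => (hi ⟨i, rfl⟩).elim) (fun i _ => ?_) j
    simp
  · refine Fin.addCases (fun i _ => ?_) (fun i hi => (hi ⟨i, rfl⟩).elim) j
    simp

/-- For any two paradigms `P1` of length `n1` and `P2` of length `n2`
over finite nonempty index sets, the merging size is attained: there exists a merged
paradigm `Q` of `P1` and `P2` with length `m` satisfying `max n1 n2 ≤ m ≤ n1 + n2` and
`size(Q) = msize(P1, P2)`.  (In particular every merged paradigm has length at least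
`max n1 n2`, and merged paradigms of length `n1 + n2` always exist.) -/
theorem msize_attained {α : Type*} [PseudoMetricSpace α] (null : α)
    {I1 I2 : Type*} [Fintype I1] [Nonempty I1] [Fintype I2] [Nonempty I2] {n1 n2 : ℕ}
    (P1 : I1 → Fin n1 → α) (P2 : I2 → Fin n2 → α) :
    (∃ (m : ℕ) (Q : I1 ⊕ I2 → Fin m → α), IsMergedParadigm null P1 P2 Q ∧
      max n1 n2 ≤ m ∧ m ≤ n1 + n2 ∧ psize Q = msize null P1 P2) ∧
    (∀ (m : ℕ) (Q : I1 ⊕ I2 → Fin m → α),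
      IsMergedParadigm null P1 P2 Q → max n1 n2 ≤ m) ∧
    (∃ Q : I1 ⊕ I2 → Fin (n1 + n2) → α, IsMergedParadigm null P1 P2 Q) := by
  have h_length : ∀ (m : ℕ) (Q : I1 ⊕ I2 → Fin m → α),
      IsMergedParadigm null P1 P2 Q → max n1 n2 ≤ m :=
    fun m Q h => max_le h.1.length_le h.2.length_le
  refine ⟨?_, h_length, exists_isMergedParadigm_add null P1 P2⟩
  have h_finite : {r : ℝ | ∃ (m : ℕ) (Q : I1 ⊕ I2 → Fin m → α),
      IsMergedParadigm null P1 P2 Q ∧ psize Q = r}.Finite := by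
    refine ((Set.finite_Iic (n1 + n2)).biUnion fun k _ =>
      (finite_setOf_isMergedParadigm null k P1 P2).image psize).subset ?_
    rintro _ ⟨m, Q, hQ, rfl⟩
    obtain ⟨k, hk, R, hR, h_size⟩ := hQ.exists_length_le
    exact Set.mem_biUnion hk ⟨R, hR, h_size⟩
  obtain ⟨Q₀, hQ₀⟩ := exists_isMergedParadigm_add null P1 P2
  obtain ⟨m, Q, hQ, h_size⟩ : ∃ (m : ℕ) (Q : I1 ⊕ I2 → Fin m → α),
      IsMergedParadigm null P1 P2 Q ∧ psize Q = msize null P1 P2 :=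
    Set.Nonempty.csInf_mem (s := {r : ℝ | ∃ (m : ℕ) (Q : I1 ⊕ I2 → Fin m → α),
      IsMergedParadigm null P1 P2 Q ∧ psize Q = r}) ⟨_, _, Q₀, hQ₀, rfl⟩ h_finite
  obtain ⟨k, hk, R, hR, h_eq⟩ := hQ.exists_length_le
  exact ⟨k, R, hR, h_length k R hR, hk, h_eq.trans h_size⟩
end

section
/- (Confidence-based pruning is sound.) Let C1 and C2 be nonempty finite multisets of key-value pairs and let c be a real number. If Support(C1) < c · card(C1) and Support(C2) < c · card(C2), then Support(C1 + C2) < c · card(C1 + C2); equivalently, if two dependencies each have confidence Support/card below the threshold c, the dependency obtained from their combined claim set also has confidence below c. -/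
/-- The support of a finite multiset `C` of key-value pairs:
`Support(C) = ∑_k max_v count((k, v), C)`, where the sum ranges over the distinct keys
`k` occurring in `C` and the max ranges over the distinct values `v` paired with `k`
in `C`. -/
def msupport {K V : Type*} [DecidableEq K] [DecidableEq V]
    (C : Multiset (K × V)) : ℕ :=
  ∑ k ∈ (C.map Prod.fst).toFinset,
    (C.toFinset.filter fun p => p.1 = k).sup fun p => C.count p

/-- The sum defining the support may be taken over any finite set containing all keys. -/
theorem msupport_eq_sum_of_subset {K V : Type*} [DecidableEq K] [DecidableEq V]
    {C : Multiset (K × V)} {S : Finset K} (hS : (C.map Prod.fst).toFinset ⊆ S) :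
    msupport C =
      ∑ k ∈ S, (C.toFinset.filter fun p => p.1 = k).sup fun p => C.count p := by
  refine Finset.sum_subset hS fun k _ hk => ?_
  rw [Finset.filter_eq_empty_iff.mpr, Finset.sup_empty, Nat.bot_eq_zero]
  rintro p hp rfl
  exact hk (Multiset.mem_toFinset.mpr
    (Multiset.mem_map_of_mem Prod.fst (Multiset.mem_toFinset.mp hp)))

/-- The multiplicity of a pair is at most the largest multiplicity among pairs with its key. -/
theorem count_le_sup_count {K V : Type*} [DecidableEq K] [DecidableEq V]
    (C : Multiset (K × V)) (p : K × V) :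
    C.count p ≤ (C.toFinset.filter fun q => q.1 = p.1).sup fun q => C.count q := by
  by_cases hp : p ∈ C
  · exact Finset.le_sup (f := fun q => C.count q) (by simpa using hp)
  · simp [Multiset.count_eq_zero_of_notMem hp]

/-- The support is subadditive. -/
theorem msupport_add_le {K V : Type*} [DecidableEq K] [DecidableEq V]
    (C D : Multiset (K × V)) : msupport (C + D) ≤ msupport C + msupport D := by
  have hC : (C.map Prod.fst).toFinset ⊆ ((C + D).map Prod.fst).toFinset := by
    simp [Multiset.toFinset_add]
  have hD : (D.map Prod.fst).toFinset ⊆ ((C + D).map Prod.fst).toFinset := by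
    simp [Multiset.toFinset_add]
  rw [msupport_eq_sum_of_subset hC, msupport_eq_sum_of_subset hD, ← Finset.sum_add_distrib]
  refine Finset.sum_le_sum fun k _ => Finset.sup_le fun p hp => ?_
  obtain rfl := (Finset.mem_filter.mp hp).2
  rw [Multiset.count_add]
  exact add_le_add (count_le_sup_count C p) (count_le_sup_count D p)

/-- **Confidence-based pruning is sound.** If `C1` and `C2` are nonempty
finite multisets of key-value pairs with `Support(C1) < c · card(C1)` and
`Support(C2) < c · card(C2)`, then `Support(C1 + C2) < c · card(C1 + C2)`. -/
theorem confidence_pruning_sound {K V : Type*} [DecidableEq K] [DecidableEq V]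
    (C1 C2 : Multiset (K × V)) (hC1 : C1 ≠ 0) (hC2 : C2 ≠ 0) (c : ℝ)
    (h1 : (msupport C1 : ℝ) < c * (Multiset.card C1 : ℝ))
    (h2 : (msupport C2 : ℝ) < c * (Multiset.card C2 : ℝ)) :
    (msupport (C1 + C2) : ℝ) < c * (Multiset.card (C1 + C2) : ℝ) := by
  have h : (msupport (C1 + C2) : ℝ) ≤ msupport C1 + msupport C2 := by
    exact_mod_cast msupport_add_le C1 C2
  rw [Multiset.card_add, Nat.cast_add, mul_add]
  linarith
end
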